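/- arXiv:1309.7712 — 2 statements merged into one kernel-verified Lean document; each statement's English description precedes it below -/
import Mathlib

section
/- For every training matrix X in the unitary training set 𝒳 = {X ∈ ℂ^{N_t × T} : X^H X = ρ I_T}, the training matrix X_opt = √ρ · U_{[1:T]} satisfies MSE(X_opt) ≤ MSE(X); that is, √ρ times the first T columns of the eigenvector matrix U of R minimizes the channel-estimation MSE over all unitary training matrices. -/
open Matrix BigOperators


open scoped ComplexOrder in
lemma key_aux (Nt T : ℕ) (ρ : ℝ) (hρ : 0 < ρ)
    (lam : Fin Nt → ℝ) (hnn : ∀ t, 0 ≤ lam t)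
    (Y : Matrix (Fin Nt) (Fin T) ℂ)
    (hY : Yᴴ * Y = (ρ : ℂ) • (1 : Matrix (Fin T) (Fin T) ℂ)) :
    ∃ p : Fin Nt → ℝ, (∀ i, 0 ≤ p i) ∧ (∀ i, p i ≤ 1) ∧ (∑ i, p i = T) ∧
      (∀ i, (∀ t, Y i t = 0) → p i = 0) ∧
      (diagonal (fun t => (lam t : ℂ)) * Y * (1 + Yᴴ * diagonal (fun t => (lam t : ℂ)) * Y)⁻¹
        * Yᴴ * diagonal (fun t => (lam t : ℂ))).trace.re
        = ∑ i, lam i ^ 2 / (ρ⁻¹ + lam i) * p i := by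
  set L : Matrix (Fin Nt) (Fin Nt) ℂ := diagonal (fun t => (lam t : ℂ)) with hL
  set A := 1 + Yᴴ * L * Y with hA
  have hLp : L.PosSemidef := by
    rw [hL]
    refine PosSemidef.diagonal ?_
    intro i
    simpa using hnn i
  have hAp : A.PosDef := PosDef.one.add_posSemidef (hLp.conjTranspose_mul_mul_same Y)
  have hAu : IsUnit A.det := (Matrix.isUnit_iff_isUnit_det A).1 hAp.isUnit
  have hAi : A⁻¹ᴴ = A⁻¹ := hAp.isHermitian.inv
  set E : Matrix (Fin Nt) (Fin Nt) ℂ := diagonal (fun t => ((ρ⁻¹ + lam t : ℝ) : ℂ)) with hE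
  have hρc : (ρ : ℂ) ≠ 0 := by exact_mod_cast hρ.ne'
  have hEL : E = (ρ : ℂ)⁻¹ • (1 : Matrix (Fin Nt) (Fin Nt) ℂ) + L := by
    rw [hE, hL, ← diagonal_one, ← diagonal_smul, diagonal_add]
    congr 1
    ext i
    simp
  have hAE : Yᴴ * E * Y = A := by
    rw [hEL, hA, Matrix.mul_add, Matrix.add_mul]
    congr 1
    rw [Matrix.mul_smul, Matrix.smul_mul, Matrix.mul_one, hY, smul_smul, inv_mul_cancel₀ hρc,
      one_smul]
  set Q := Y * A⁻¹ * Yᴴ with hQ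
  have hQh : Qᴴ = Q := by
    rw [hQ]
    simp only [conjTranspose_mul, conjTranspose_conjTranspose, hAi, Matrix.mul_assoc]
  have hQEQ : Q * E * Q = Q := by
    calc Q * E * Q = Y * A⁻¹ * (Yᴴ * E * Y) * A⁻¹ * Yᴴ := by
          rw [hQ]; simp only [Matrix.mul_assoc]
      _ = Q := by
          rw [hAE, Matrix.mul_assoc Y, Matrix.nonsing_inv_mul _ hAu, Matrix.mul_one]
  have htr : (Q * E).trace = (T : ℂ) := by
    rw [hQ, Matrix.mul_assoc, Matrix.mul_assoc, Matrix.trace_mul_comm, Matrix.mul_assoc, hAE,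
      Matrix.nonsing_inv_mul _ hAu, Matrix.trace_one, Fintype.card_fin]
  have he : ∀ i, 0 < ρ⁻¹ + lam i := fun i => add_pos_of_pos_of_nonneg (inv_pos.2 hρ) (hnn i)
  have hdiag : ∀ i, (Q i i).re = ∑ j, (ρ⁻¹ + lam j) * Complex.normSq (Q i j) := by
    intro i
    have h1 : Q i i = ∑ j, (((ρ⁻¹ + lam j) * Complex.normSq (Q i j) : ℝ) : ℂ) := by
      conv_lhs => rw [← hQEQ]
      rw [Matrix.mul_apply]
      refine Finset.sum_congr rfl fun j _ => ?_
      have h2 : Q j i = star (Q i j) := by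
        conv_lhs => rw [← hQh]
        rfl
      rw [hE, Matrix.mul_diagonal, h2, Complex.ofReal_mul, ← Complex.mul_conj]
      simp only [Complex.star_def]
      ring
    rw [h1, ← Complex.ofReal_sum, Complex.ofReal_re]
  have hq0 : ∀ i, 0 ≤ (Q i i).re := by
    intro i
    rw [hdiag]
    exact Finset.sum_nonneg fun j _ => mul_nonneg (he j).le (Complex.normSq_nonneg _)
  have hq1 : ∀ i, (ρ⁻¹ + lam i) * (Q i i).re ^ 2 ≤ (Q i i).re := by
    intro i
    have h1 : (ρ⁻¹ + lam i) * Complex.normSq (Q i i) ≤ (Q i i).re := by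
      conv_rhs => rw [hdiag]
      exact Finset.single_le_sum (f := fun j => (ρ⁻¹ + lam j) * Complex.normSq (Q i j))
        (fun j _ => mul_nonneg (he j).le (Complex.normSq_nonneg _)) (Finset.mem_univ i)
    refine le_trans (mul_le_mul_of_nonneg_left ?_ (he i).le) h1
    rw [Complex.normSq_apply]
    nlinarith [mul_self_nonneg (Q i i).im]
  refine ⟨fun i => (ρ⁻¹ + lam i) * (Q i i).re, fun i => mul_nonneg (he i).le (hq0 i), ?_, ?_, ?_, ?_⟩
  · intro i
    rcases (hq0 i).eq_or_lt with h | h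
    · simp [← h]
    · have := hq1 i
      show (ρ⁻¹ + lam i) * (Q i i).re ≤ 1
      by_contra hc
      push Not at hc
      nlinarith
  · have := congrArg Complex.re htr
    rw [Matrix.trace, Complex.re_sum] at this
    simp only [Complex.natCast_re] at this
    rw [← this]
    refine Finset.sum_congr rfl fun i _ => ?_
    rw [Matrix.diag_apply, hE, Matrix.mul_diagonal, Complex.re_mul_ofReal, mul_comm]
  · intro i hi
    have : Q i i = 0 := by
      rw [hQ, Matrix.mul_assoc, Matrix.mul_apply]
      simp [hi]
    simp [this]
  · have h1 : L * Y * A⁻¹ * Yᴴ * L = L * Q * L := by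
      rw [hQ]; simp only [Matrix.mul_assoc]
    rw [h1, Matrix.trace, Complex.re_sum]
    refine Finset.sum_congr rfl fun i _ => ?_
    rw [Matrix.diag_apply, hL, Matrix.mul_diagonal, Matrix.diagonal_mul, Complex.re_mul_ofReal,
      Complex.re_ofReal_mul]
    have := (he i).ne'
    rw [← mul_assoc, div_mul_cancel₀ _ this]
    ring

lemma trace_aux (Nt T : ℕ)
    (U : Matrix (Fin Nt) (Fin Nt) ℂ) (hU1 : Uᴴ * U = 1)
    (L R : Matrix (Fin Nt) (Fin Nt) ℂ) (hR : R = U * L * Uᴴ)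
    (X : Matrix (Fin Nt) (Fin T) ℂ) :
    (R * X * (1 + Xᴴ * R * X)⁻¹ * Xᴴ * R).trace
      = (L * (Uᴴ * X) * (1 + (Uᴴ * X)ᴴ * L * (Uᴴ * X))⁻¹ * (Uᴴ * X)ᴴ * L).trace := by
  have h1 : Xᴴ * R * X = (Uᴴ * X)ᴴ * L * (Uᴴ * X) := by
    rw [hR]
    simp only [conjTranspose_mul, conjTranspose_conjTranspose, Matrix.mul_assoc]
  rw [h1]
  generalize (1 + (Uᴴ * X)ᴴ * L * (Uᴴ * X))⁻¹ = B
  have h2 : R * X * B * Xᴴ * R = U * ((L * (Uᴴ * X) * B * (Uᴴ * X)ᴴ * L) * Uᴴ) := by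
    rw [hR]
    simp only [conjTranspose_mul, conjTranspose_conjTranspose, Matrix.mul_assoc]
  rw [h2, Matrix.trace_mul_comm, Matrix.mul_assoc, hU1, Matrix.mul_one]

/-- `√ρ · U_{[1:T]}` minimizes the channel-estimation MSE over all
unitary training matrices `X` with `Xᴴ X = ρ I_T`. -/
theorem stmt_0 (Nt T : ℕ) (hNt : 0 < Nt) (hT : 0 < T) (hTN : T ≤ Nt)
    (ρ : ℝ) (hρ : 0 < ρ)
    (U : Matrix (Fin Nt) (Fin Nt) ℂ) (hU1 : Uᴴ * U = 1) (hU2 : U * Uᴴ = 1)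
    (lam : Fin Nt → ℝ) (hnn : ∀ t, 0 ≤ lam t) (hmono : Antitone lam)
    (R : Matrix (Fin Nt) (Fin Nt) ℂ)
    (hR : R = U * Matrix.diagonal (fun t => (lam t : ℂ)) * Uᴴ)
    (Xopt : Matrix (Fin Nt) (Fin T) ℂ)
    (hXopt : Xopt = fun i t => (Real.sqrt ρ : ℂ) * U i (Fin.castLE hTN t))
    (X : Matrix (Fin Nt) (Fin T) ℂ)
    (hX : Xᴴ * X = (ρ : ℂ) • (1 : Matrix (Fin T) (Fin T) ℂ)) :
    (1 / (Nt : ℝ)) * (R - R * Xopt * (1 + Xoptᴴ * R * Xopt)⁻¹ * Xoptᴴ * R).trace.re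
      ≤ (1 / (Nt : ℝ)) * (R - R * X * (1 + Xᴴ * R * X)⁻¹ * Xᴴ * R).trace.re := by
  have hXX : Xoptᴴ * Xopt = (ρ : ℂ) • (1 : Matrix (Fin T) (Fin T) ℂ) := by
    ext s t
    have h := congrFun (congrFun hU1 (Fin.castLE hTN s)) (Fin.castLE hTN t)
    have hs : (Real.sqrt ρ : ℂ) * (Real.sqrt ρ : ℂ) = ρ := by
      rw [← Complex.ofReal_mul, Real.mul_self_sqrt hρ.le]
    have h3 : (Xoptᴴ * Xopt) s t
        = (ρ : ℂ) * (Uᴴ * U) (Fin.castLE hTN s) (Fin.castLE hTN t) := by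
      rw [Matrix.mul_apply, Matrix.mul_apply, Finset.mul_sum]
      refine Finset.sum_congr rfl fun j _ => ?_
      have h5 : ∀ a b, Xopt a b = (Real.sqrt ρ : ℂ) * U a (Fin.castLE hTN b) := by
        intro a b
        rw [hXopt]
      rw [conjTranspose_apply, h5, h5, ← hs]
      simp only [conjTranspose_apply, Complex.star_def, map_mul, Complex.conj_ofReal]
      ring
    rw [h3, h, Matrix.smul_apply, Matrix.one_apply, Matrix.one_apply, smul_eq_mul]
    simp
  have hYY : ∀ Z : Matrix (Fin Nt) (Fin T) ℂ, (Uᴴ * Z)ᴴ * (Uᴴ * Z) = Zᴴ * Z := by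
    intro Z
    rw [conjTranspose_mul, conjTranspose_conjTranspose, Matrix.mul_assoc, ← Matrix.mul_assoc U,
      hU2, Matrix.one_mul]
  obtain ⟨p, p0, p1, ps, -, pt⟩ := key_aux Nt T ρ hρ lam hnn (Uᴴ * X) (by rw [hYY, hX])
  obtain ⟨q, q0, q1, qs, qz, qt⟩ := key_aux Nt T ρ hρ lam hnn (Uᴴ * Xopt) (by rw [hYY, hXX])
  have hqz : ∀ i : Fin Nt, T ≤ i.val → q i = 0 := by
    intro i hi
    refine qz i fun t => ?_
    have h3 : (Uᴴ * Xopt) i t = (Real.sqrt ρ : ℂ) * (Uᴴ * U) i (Fin.castLE hTN t) := by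
      rw [Matrix.mul_apply, Matrix.mul_apply, Finset.mul_sum]
      refine Finset.sum_congr rfl fun j _ => ?_
      rw [hXopt]
      ring
    have hne : i ≠ Fin.castLE hTN t := by
      intro h
      have := congrArg Fin.val h
      have h4 := t.isLt
      simp at this
      omega
    rw [h3, hU1, Matrix.one_apply_ne hne, mul_zero]
  have hqo : ∀ i : Fin Nt, i.val < T → q i = 1 := by
    have hc : ∑ i : Fin Nt, (if i.val < T then (1 : ℝ) else 0) = T := by
      rw [Finset.sum_boole, Fin.card_filter_val_lt, min_eq_right hTN]
    have h0 : ∑ i : Fin Nt, ((if i.val < T then (1 : ℝ) else 0) - q i) = 0 := by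
      rw [Finset.sum_sub_distrib, hc, qs, sub_self]
    rw [Finset.sum_eq_zero_iff_of_nonneg] at h0
    · intro i hi
      have := h0 i (Finset.mem_univ i)
      rw [if_pos hi] at this
      linarith
    · intro i _
      split_ifs with h
      · linarith [q1 i]
      · rw [hqz i (not_lt.1 h)]; simp
  have hg : ∀ i j : Fin Nt, i ≤ j →
      lam j ^ 2 / (ρ⁻¹ + lam j) ≤ lam i ^ 2 / (ρ⁻¹ + lam i) := by
    intro i j hij
    have h1 := hmono hij
    have h2 := hnn j
    have h3 := hnn i
    have h4 : 0 < ρ⁻¹ := inv_pos.2 hρ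
    rw [div_le_div_iff₀ (by linarith) (by linarith)]
    have h5 : lam j ^ 2 ≤ lam i ^ 2 := pow_le_pow_left₀ h2 h1 2
    have h6 := mul_le_mul_of_nonneg_right h5 h4.le
    have h7 := mul_le_mul_of_nonneg_left h1 (mul_nonneg h2 h3)
    nlinarith
  let k : Fin Nt := ⟨T - 1, by omega⟩
  have hmain : ∑ i, lam i ^ 2 / (ρ⁻¹ + lam i) * p i ≤ ∑ i, lam i ^ 2 / (ρ⁻¹ + lam i) * q i := by
    have h0 : ∑ i, (lam i ^ 2 / (ρ⁻¹ + lam i) - lam k ^ 2 / (ρ⁻¹ + lam k)) * (p i - q i) ≤ 0 := by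
      refine Finset.sum_nonpos fun i _ => ?_
      by_cases h : i.val < T
      · have h1 := hg i k (by rw [Fin.le_def]; show i.val ≤ T - 1; omega)
        refine mul_nonpos_of_nonneg_of_nonpos (by linarith) ?_
        rw [hqo i h]; linarith [p1 i]
      · have h1 := hg k i (by rw [Fin.le_def]; show T - 1 ≤ i.val; omega)
        refine mul_nonpos_of_nonpos_of_nonneg (by linarith) ?_
        rw [hqz i (not_lt.1 h)]; linarith [p0 i]
    have h1 : ∑ i, (lam i ^ 2 / (ρ⁻¹ + lam i) - lam k ^ 2 / (ρ⁻¹ + lam k)) * (p i - q i)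
        = ∑ i, lam i ^ 2 / (ρ⁻¹ + lam i) * p i - ∑ i, lam i ^ 2 / (ρ⁻¹ + lam i) * q i
          - lam k ^ 2 / (ρ⁻¹ + lam k) * (∑ i, p i - ∑ i, q i) := by
      rw [← Finset.sum_sub_distrib, ← Finset.sum_sub_distrib, Finset.mul_sum,
        ← Finset.sum_sub_distrib]
      refine Finset.sum_congr rfl fun i _ => ?_
      ring
    rw [h1, ps, qs] at h0
    linarith
  refine mul_le_mul_of_nonneg_left ?_ (by positivity)
  rw [Matrix.trace_sub, Matrix.trace_sub, Complex.sub_re, Complex.sub_re,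
    trace_aux Nt T U hU1 _ R hR X, trace_aux Nt T U hU1 _ R hR Xopt, pt, qt]
  linarith
end

section
/- (Block generalized Rayleigh quotient, diagonal case) Let N ≥ T ≥ 1, let d¹, d² ∈ ℝ^N satisfy d¹_t > 0 and d²_t ≥ 0 for all t, with the ratios d²_t / d¹_t nonincreasing in t, and let D¹ = diag(d¹), D² = diag(d²). Then for every X ∈ ℂ^{N × T} with X^H X = ρ I_T (ρ > 0), tr( (X^H D¹ X)^{-1} X^H D² X ) ≤ Σ_{t=1}^{T} d²_t / d¹_t, and equality holds for X = √ρ times the first T standard basis columns. -/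
open Matrix BigOperators

lemma aux_sum (N T : ℕ) (hT : 0 < T) (hTN : T ≤ N) (r p : Fin N → ℝ) (hr : Antitone r)
    (h0 : ∀ i, 0 ≤ p i) (h1 : ∀ i, p i ≤ 1) (hs : ∑ i, p i = T) :
    ∑ i, r i * p i ≤ ∑ t : Fin T, r (Fin.castLE hTN t) := by
  obtain ⟨k, rfl⟩ := Nat.exists_eq_add_of_le hTN
  have hc : ∀ t : Fin T, Fin.castLE hTN t = Fin.castAdd k t := fun t => rfl
  simp only [hc]
  obtain ⟨c, hcdef⟩ : ∃ c, c = r (Fin.castAdd k ⟨T - 1, by omega⟩) := ⟨_, rfl⟩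
  rw [Fin.sum_univ_add] at hs ⊢
  have e1 : ∑ i : Fin T, r (Fin.castAdd k i) * p (Fin.castAdd k i)
      ≤ ∑ i : Fin T, (r (Fin.castAdd k i) - c + c * p (Fin.castAdd k i)) := by
    apply Finset.sum_le_sum
    intro i _
    have : c ≤ r (Fin.castAdd k i) := by
      rw [hcdef]
      apply hr
      rw [Fin.le_def]
      simp only [Fin.val_castAdd]
      omega
    nlinarith [h1 (Fin.castAdd k i)]
  have e2 : ∑ i : Fin k, r (Fin.natAdd T i) * p (Fin.natAdd T i)
      ≤ ∑ i : Fin k, c * p (Fin.natAdd T i) := by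
    apply Finset.sum_le_sum
    intro i _
    have : r (Fin.natAdd T i) ≤ c := by
      rw [hcdef]
      apply hr
      rw [Fin.le_def]
      simp only [Fin.val_castAdd, Fin.val_natAdd]
      omega
    exact mul_le_mul_of_nonneg_right this (h0 _)
  rw [Finset.sum_add_distrib, Finset.sum_sub_distrib, ← Finset.mul_sum] at e1
  rw [← Finset.mul_sum] at e2
  simp only [Finset.sum_const, Finset.card_univ, Fintype.card_fin, nsmul_eq_mul] at e1
  have : c * (∑ i : Fin T, p (Fin.castAdd k i)) + c * (∑ i : Fin k, p (Fin.natAdd T i)) = T * c := by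
    rw [← mul_add, hs, mul_comm]
  linarith

lemma aux_proj {n : ℕ} (P : Matrix (Fin n) (Fin n) ℂ) (hP : Pᴴ = P) (hPP : P * P = P) (i : Fin n) :
    0 ≤ (P i i).re ∧ (P i i).re ≤ 1 := by
  have h : (P i i).re = ∑ j, Complex.normSq (P j i) := by
    have h2 : (Pᴴ * P) i i = P i i := by rw [hP, hPP]
    rw [← h2, Matrix.mul_apply, Complex.re_sum]
    apply Finset.sum_congr rfl
    intro j _
    simp [Matrix.conjTranspose_apply, Complex.normSq_apply]
  have h3 : Complex.normSq (P i i) ≤ (P i i).re := by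
    rw [h]
    exact Finset.single_le_sum (f := fun j => Complex.normSq (P j i))
      (fun j _ => Complex.normSq_nonneg _) (Finset.mem_univ i)
  rw [Complex.normSq_apply] at h3
  constructor
  · rw [h]; exact Finset.sum_nonneg fun j _ => Complex.normSq_nonneg _
  · nlinarith [mul_self_nonneg (P i i).im]

lemma aux_X0 (N T : ℕ) (hTN : T ≤ N) (ρ : ℝ) (hρ : 0 < ρ) (d : Fin N → ℝ)
    (X0 : Matrix (Fin N) (Fin T) ℂ)
    (hX0 : X0 = fun i t => if i = Fin.castLE hTN t then (Real.sqrt ρ : ℂ) else 0) :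
    X0ᴴ * Matrix.diagonal (fun t => (d t : ℂ)) * X0
      = Matrix.diagonal (fun t => ((ρ * d (Fin.castLE hTN t) : ℝ) : ℂ)) := by
  have hs : (Real.sqrt ρ : ℂ) * (Real.sqrt ρ : ℂ) = ρ := by
    rw [← Complex.ofReal_mul, Real.mul_self_sqrt hρ.le]
  ext s t
  rw [Matrix.mul_apply, Finset.sum_eq_single (Fin.castLE hTN t)]
  · rw [Matrix.mul_diagonal, Matrix.conjTranspose_apply, hX0]
    by_cases hst : s = t
    · subst hst
      simp only [if_true, Matrix.diagonal_apply_eq]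
      rw [Complex.star_def, Complex.conj_ofReal, Complex.ofReal_mul, ← hs]
      ring
    · have : Fin.castLE hTN t ≠ Fin.castLE hTN s := fun h => hst (Fin.castLE_injective hTN h).symm
      simp [this, hst]
  · intro b _ hb
    simp [hX0, hb]
  · simp

open scoped ComplexOrder in
lemma aux_pd (N T : ℕ) (d1 : Fin N → ℝ) (hd1 : ∀ t, 0 < d1 t) (X : Matrix (Fin N) (Fin T) ℂ)
    (hinj : Function.Injective X.mulVec) :
    IsUnit (Xᴴ * Matrix.diagonal (fun t => (d1 t : ℂ)) * X).det ∧
    (Xᴴ * Matrix.diagonal (fun t => (d1 t : ℂ)) * X).IsHermitian := by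
  have hD1pd : (Matrix.diagonal (fun t => (d1 t : ℂ))).PosDef := by
    apply Matrix.PosDef.diagonal
    intro i
    exact_mod_cast hd1 i
  have hA := hD1pd.conjTranspose_mul_mul_same hinj
  exact ⟨(Matrix.isUnit_iff_isUnit_det _).1 hA.isUnit, hA.isHermitian⟩

/-- block generalized Rayleigh quotient, diagonal case: for real
diagonal `D¹ ≻ 0`, `D² ⪰ 0` with nonincreasing ratios `d²_t/d¹_t`, and any `X`
with `Xᴴ X = ρ I_T`, `tr((Xᴴ D¹ X)⁻¹ Xᴴ D² X) ≤ Σ_{t=1}^T d²_t/d¹_t`, with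
equality for `X = √ρ` times the first `T` standard basis columns. -/
theorem stmt_12 (N T : ℕ) (hT : 0 < T) (hTN : T ≤ N)
    (ρ : ℝ) (hρ : 0 < ρ)
    (d1 d2 : Fin N → ℝ) (hd1 : ∀ t, 0 < d1 t) (hd2 : ∀ t, 0 ≤ d2 t)
    (hratio : Antitone (fun t => d2 t / d1 t))
    (D1 D2 : Matrix (Fin N) (Fin N) ℂ)
    (hD1 : D1 = Matrix.diagonal (fun t => (d1 t : ℂ)))
    (hD2 : D2 = Matrix.diagonal (fun t => (d2 t : ℂ)))
    (X0 : Matrix (Fin N) (Fin T) ℂ)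
    (hX0 : X0 = fun i t => if i = Fin.castLE hTN t then (Real.sqrt ρ : ℂ) else 0) :
    (∀ X : Matrix (Fin N) (Fin T) ℂ,
        Xᴴ * X = (ρ : ℂ) • (1 : Matrix (Fin T) (Fin T) ℂ) →
        ((Xᴴ * D1 * X)⁻¹ * (Xᴴ * D2 * X)).trace.re
          ≤ ∑ t : Fin T, d2 (Fin.castLE hTN t) / d1 (Fin.castLE hTN t))
    ∧ ((X0ᴴ * D1 * X0)⁻¹ * (X0ᴴ * D2 * X0)).trace
        = ((∑ t : Fin T, d2 (Fin.castLE hTN t) / d1 (Fin.castLE hTN t) : ℝ) : ℂ) := by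
  have hd1c : ∀ t, (d1 t : ℂ) ≠ 0 := fun t => by exact_mod_cast (hd1 t).ne'
  constructor
  · intro X hX
    have hinj : Function.Injective X.mulVec := by
      intro v w hvw
      have h := congrArg (fun u => Xᴴ *ᵥ u) hvw
      simp only [Matrix.mulVec_mulVec, hX, Matrix.smul_mulVec, Matrix.one_mulVec] at h
      exact smul_right_injective _ (by exact_mod_cast hρ.ne' : (ρ : ℂ) ≠ 0) h
    obtain ⟨hu, hAh⟩ := aux_pd N T d1 hd1 X hinj
    rw [← hD1] at hu hAh
    have hBh : ((Xᴴ * D1 * X)⁻¹)ᴴ = (Xᴴ * D1 * X)⁻¹ := hAh.inv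
    have hBA := Matrix.nonsing_inv_mul _ hu
    obtain ⟨S, hSdef⟩ : ∃ S : Matrix (Fin N) (Fin N) ℂ,
      S = Matrix.diagonal (fun t => (Real.sqrt (d1 t) : ℂ)) := ⟨_, rfl⟩
    have hSS : D1 = S * S := by
      rw [hSdef, hD1, Matrix.diagonal_mul_diagonal]
      congr 1; ext t
      rw [← Complex.ofReal_mul, Real.mul_self_sqrt (hd1 t).le]
    have hSh : Sᴴ = S := by
      rw [hSdef, Matrix.diagonal_conjTranspose]
      congr 1; ext t
      simp
    obtain ⟨R, hR⟩ : ∃ R : Matrix (Fin N) (Fin N) ℂ,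
      R = Matrix.diagonal (fun t => ((d2 t / d1 t : ℝ) : ℂ)) := ⟨_, rfl⟩
    have hSRS : D2 = S * R * S := by
      rw [hSdef, hR, hD2, Matrix.diagonal_mul_diagonal, Matrix.diagonal_mul_diagonal]
      congr 1; ext t
      have h1 := Real.mul_self_sqrt (hd1 t).le
      rw [← Complex.ofReal_mul, ← Complex.ofReal_mul, mul_right_comm, h1,
        mul_div_cancel₀ _ (hd1 t).ne']
    obtain ⟨B, hB⟩ : ∃ B, B = (Xᴴ * D1 * X)⁻¹ := ⟨_, rfl⟩
    rw [← hB] at hBA hBh ⊢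
    rw [hSS] at hBA
    obtain ⟨P, hP⟩ : ∃ P, P = S * X * B * Xᴴ * S := ⟨_, rfl⟩
    have hPh : Pᴴ = P := by
      rw [hP]
      simp only [Matrix.conjTranspose_mul, hSh, hBh, Matrix.conjTranspose_conjTranspose,
        Matrix.mul_assoc]
    have hPP : P * P = P := by
      calc P * P = S * X * (B * (Xᴴ * (S * S) * X)) * B * Xᴴ * S := by
            rw [hP]; simp only [Matrix.mul_assoc]
        _ = P := by rw [hBA, hP, Matrix.mul_one]
    have htr : P.trace = T := by
      have : P.trace = (B * (Xᴴ * (S * S) * X)).trace := by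
        rw [hP, show S * X * B * Xᴴ * S = (S * X) * (B * Xᴴ * S) by
          simp only [Matrix.mul_assoc], Matrix.trace_mul_comm]
        simp only [Matrix.mul_assoc]
      rw [this, hBA]
      simp
    have htr2 : (B * (Xᴴ * D2 * X)).trace = (R * P).trace := by
      rw [hSRS, hP, show R * (S * X * B * Xᴴ * S) = (R * S * X) * (B * Xᴴ * S) by
          simp only [Matrix.mul_assoc], Matrix.trace_mul_comm (R * S * X)]
      simp only [Matrix.mul_assoc]
    have hre : (R * P).trace.re = ∑ i, d2 i / d1 i * (P i i).re := by
      rw [Matrix.trace, Complex.re_sum]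
      apply Finset.sum_congr rfl
      intro i _
      rw [Matrix.diag_apply, hR, Matrix.diagonal_mul, Complex.re_ofReal_mul]
    rw [htr2, hre]
    refine aux_sum N T hT hTN (fun t => d2 t / d1 t) (fun i => (P i i).re) hratio
      (fun i => (aux_proj P hPh hPP i).1) (fun i => (aux_proj P hPh hPP i).2) ?_
    have := congrArg Complex.re htr
    rw [Matrix.trace, Complex.re_sum] at this
    simpa using this
  · rw [hD1, hD2, aux_X0 N T hTN ρ hρ d1 X0 hX0, aux_X0 N T hTN ρ hρ d2 X0 hX0]
    have hinv : (Matrix.diagonal (fun t : Fin T => ((ρ * d1 (Fin.castLE hTN t) : ℝ) : ℂ)))⁻¹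
        = Matrix.diagonal (fun t : Fin T => (((ρ * d1 (Fin.castLE hTN t))⁻¹ : ℝ) : ℂ)) := by
      apply Matrix.inv_eq_left_inv
      rw [Matrix.diagonal_mul_diagonal, ← Matrix.diagonal_one]
      congr 1; ext t
      rw [← Complex.ofReal_mul, inv_mul_cancel₀ (mul_pos hρ (hd1 _)).ne']
      simp
    rw [hinv, Matrix.diagonal_mul_diagonal, Matrix.trace_diagonal, Complex.ofReal_sum]
    apply Finset.sum_congr rfl
    intro t _
    rw [← Complex.ofReal_mul]
    congr 1
    have := (hd1 (Fin.castLE hTN t)).ne'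
    have := hρ.ne'
    field_simp
end
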